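/- (Proposition 2.) Let J be a finite index set, and for each i ∈ J let S_i be a subdivision of [0,1] with m_i ≥ 2 ordered knots 0 = t^{(S_i)}_(1) < ... < t^{(S_i)}_(m_i) = 1. Fix i* ∈ J and t ∈ (0,1) with t ∉ S_{i*}, and let ν ∈ {1, ..., m_{i*}-1} satisfy t^{(S_{i*})}_(ν) < t < t^{(S_{i*})}_(ν+1). Set S̃_i = S_i for i ≠ i* and S̃_{i*} = S_{i*} ∪ {t}, with hat basis functions φ̃_{i,j} (j = 1, ..., m̃_i, where m̃_i = m_i for i ≠ i* and m̃_{i*} = m_{i*}+1). Given real coefficients ξ̂_{i,j} (for i ∈ J, 1 ≤ j ≤ m_i) and ξ̃_{i,j} (for i ∈ J, 1 ≤ j ≤ m̃_i), define ξ̄_{i,j} = ξ̂_{i,j} for i ≠ i*; ξ̄_{i*,j} = ξ̂_{i*,j} for j ≤ ν; ξ̄_{i*,j} = ξ̂_{i*,j-1} for j ≥ ν+2; and ξ̄_{i*,ν+1} = ξ̂_{i*,ν} · (t^{(S_{i*})}_(ν+1) − t)/(t^{(S_{i*})}_(ν+1) − t^{(S_{i*})}_(ν)) + ξ̂_{i*,ν+1}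 · (t − t^{(S_{i*})}_(ν))/(t^{(S_{i*})}_(ν+1) − t^{(S_{i*})}_(ν)). Set η̄_{i,j} = ξ̄_{i,j} − ξ̃_{i,j}, E^{(S̃_i)}_j := ∫_0^1 φ̃_{i,j}, and E^{(S̃_i)}_{j,j'} := ∫_0^1 φ̃_{i,j} φ̃_{i,j'}. Then the integral over [0,1]^{|J|} of ( Σ_{i∈J} Σ_{j=1}^{m_i} ξ̂_{i,j} φ_{i,j}(x_i) − Σ_{i∈J} Σ_{j=1}^{m̃_i} ξ̃_{i,j} φ̃_{i,j}(x_i) )^2 equals Σ_{i∈J} Σ_{j,j'=1, |j-j'|≤1}^{m̃_i} η̄_{i,j} η̄_{i,j'} E^{(S̃_i)}_{j,j'} − Σ_{i∈J} ( Σ_{j=1}^{m̃_i} η̄_{i,j} E^{(S̃_i)}_j )^2 + ( Σ_{i∈J} Σ_{j=1}^{m̃_i} η̄_{i,j} E^{(S̃_i)}_j )^2. -/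

import Mathlib

open MeasureTheory

/-- The hat function with nodes `u < v < w`. -/
noncomputable def hatFn (u v w t : ℝ) : ℝ :=
  if u ≤ t ∧ t ≤ v then (t - u) / (v - u)
  else if v ≤ t ∧ t ≤ w then (w - t) / (w - v)
  else 0

/-- The hat basis function centered at the `j`-th knot of the subdivision with
ordered knots `u 1 < ... < u m` (conventions `u 0 = -1`, `u (m+1) = 2`). -/
noncomputable def hatBasis (u : ℕ → ℝ) (j : ℕ) (t : ℝ) : ℝ :=
  hatFn (u (j - 1)) (u j) (u (j + 1)) t

section Hat

variable {v : ℕ → ℝ} {M : ℕ}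

theorem knots_lt (hv : ∀ k ≤ M, v k < v (k + 1)) {a b : ℕ} (hab : a < b) (hb : b ≤ M + 1) :
    v a < v b := by
  induction b, hab using Nat.le_induction with
  | base => exact hv a (by omega)
  | succ b _ ih => exact (ih (by omega)).trans (hv b (by omega))

theorem knots_le (hv : ∀ k ≤ M, v k < v (k + 1)) {a b : ℕ} (hab : a ≤ b) (hb : b ≤ M + 1) :
    v a ≤ v b := by
  rcases hab.eq_or_lt with rfl | h
  · exact le_rfl
  · exact (knots_lt hv h hb).le

theorem exists_cell {x : ℝ} (hM : 2 ≤ M) (h1 : v 1 ≤ x) (h2 : x ≤ v M) :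
    ∃ k, 1 ≤ k ∧ k < M ∧ v k ≤ x ∧ x ≤ v (k + 1) := by
  induction M, hM using Nat.le_induction with
  | base => exact ⟨1, le_rfl, by omega, h1, h2⟩
  | succ M hM ih =>
    rcases le_total x (v M) with h | h
    · obtain ⟨k, hk⟩ := ih h
      exact ⟨k, hk.1, by omega, hk.2.2⟩
    · exact ⟨M, by omega, by omega, h, h2⟩

theorem hatBasis_left (hv : ∀ k ≤ M, v k < v (k + 1)) {k : ℕ} (hk : 1 ≤ k) (hkM : k < M) {x : ℝ}
    (h1 : v k ≤ x) (h2 : x ≤ v (k + 1)) :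
    hatBasis v k x = (v (k + 1) - x) / (v (k + 1) - v k) := by
  have h3 := knots_lt hv (show k - 1 < k by omega) (by omega)
  have h4 := hv k hkM.le
  unfold hatBasis hatFn
  by_cases h : x ≤ v k
  · obtain rfl : x = v k := le_antisymm h h1
    rw [if_pos ⟨h3.le, le_rfl⟩, div_self (by linarith), div_self (by linarith)]
  · rw [if_neg (fun hh => h hh.2), if_pos ⟨h1, h2⟩]

theorem hatBasis_right {k : ℕ} {x : ℝ}
    (h1 : v k ≤ x) (h2 : x ≤ v (k + 1)) :
    hatBasis v (k + 1) x = (x - v k) / (v (k + 1) - v k) := by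
  unfold hatBasis hatFn
  rw [Nat.add_sub_cancel, if_pos ⟨h1, h2⟩]

theorem hatBasis_eq_zero (hv : ∀ k ≤ M, v k < v (k + 1)) {k j : ℕ} (hkM : k < M)
    (hj : 1 ≤ j) (hjM : j ≤ M) (hjk : j ≠ k) (hjk1 : j ≠ k + 1) {x : ℝ}
    (h1 : v k ≤ x) (h2 : x ≤ v (k + 1)) : hatBasis v j x = 0 := by
  unfold hatBasis hatFn
  rcases lt_or_ge j k with h | h
  · have h3 := knots_le hv (show j + 1 ≤ k by omega) (by omega)
    have h4 := hv j hjM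
    rw [if_neg (fun hh => by linarith [hh.2])]
    split_ifs with h5
    · rw [show v (j + 1) - x = 0 by linarith [h5.2], zero_div]
    · rfl
  · have h3 := knots_le hv (show k + 1 ≤ j - 1 by omega) (by omega)
    have h4 := knots_lt hv (show j - 1 < j by omega) (by omega)
    split_ifs with h5 h6
    · rw [show x - v (j - 1) = 0 by linarith [h5.1], zero_div]
    · linarith [h6.1]
    · rfl

theorem sum_hatBasis (hv : ∀ k ≤ M, v k < v (k + 1)) (c : ℕ → ℝ) {k : ℕ} (hk : 1 ≤ k)
    (hkM : k < M) {x : ℝ} (h1 : v k ≤ x) (h2 : x ≤ v (k + 1)) :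
    ∑ j ∈ Finset.Icc 1 M, c j * hatBasis v j x =
      c k * ((v (k + 1) - x) / (v (k + 1) - v k)) +
        c (k + 1) * ((x - v k) / (v (k + 1) - v k)) := by
  rw [← hatBasis_left hv hk hkM h1 h2, ← hatBasis_right h1 h2]
  refine Finset.sum_eq_add_of_mem k (k + 1) ?_ ?_ (by omega) ?_
  · simp; omega
  · simp; omega
  · intro j hj hne
    rw [Finset.mem_Icc] at hj
    rw [hatBasis_eq_zero hv hkM hj.1 hj.2 hne.1 hne.2 h1 h2, mul_zero]

theorem hatBasis_mul_eq_zero (hv : ∀ k ≤ M, v k < v (k + 1)) (hM : 2 ≤ M) {j j' : ℕ}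
    (hj : j ∈ Finset.Icc 1 M) (hj' : j' ∈ Finset.Icc 1 M) (hjj : ¬ (j' ≤ j + 1 ∧ j ≤ j' + 1))
    {x : ℝ} (h1 : v 1 ≤ x) (h2 : x ≤ v M) : hatBasis v j x * hatBasis v j' x = 0 := by
  obtain ⟨k, -, hkM, hk1, hk2⟩ := exists_cell hM h1 h2
  rw [Finset.mem_Icc] at hj hj'
  by_cases h : j ≠ k ∧ j ≠ k + 1
  · rw [hatBasis_eq_zero hv hkM hj.1 hj.2 h.1 h.2 hk1 hk2, zero_mul]
  · rw [hatBasis_eq_zero hv hkM hj'.1 hj'.2 (by omega) (by omega) hk1 hk2, mul_zero]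

theorem measurable_hatBasis (v : ℕ → ℝ) (j : ℕ) : Measurable (hatBasis v j) := by
  unfold hatBasis hatFn
  refine Measurable.ite measurableSet_Icc (by fun_prop) ?_
  exact Measurable.ite measurableSet_Icc (by fun_prop) measurable_const

theorem abs_hatBasis_le (hv : ∀ k ≤ M, v k < v (k + 1)) {j : ℕ} (hj : 1 ≤ j) (hjM : j ≤ M)
    (x : ℝ) : |hatBasis v j x| ≤ 1 := by
  have h3 := knots_lt hv (show j - 1 < j by omega) (by omega)
  have h4 := hv j hjM
  unfold hatBasis hatFn
  split_ifs with h h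
  · rw [abs_of_nonneg (div_nonneg (by linarith) (by linarith)), div_le_one (by linarith)]
    linarith [h.2]
  · rw [abs_of_nonneg (div_nonneg (by linarith) (by linarith)), div_le_one (by linarith)]
    linarith [h.1]
  · simp

theorem memLp_hatBasis (hv : ∀ k ≤ M, v k < v (k + 1)) {j : ℕ} (hj : j ∈ Finset.Icc 1 M)
    (p : ENNReal) (μ : Measure ℝ) [IsFiniteMeasure μ] : MemLp (hatBasis v j) p μ := by
  rw [Finset.mem_Icc] at hj
  exact MemLp.of_bound (measurable_hatBasis v j).aestronglyMeasurable 1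
    (.of_forall fun x => abs_hatBasis_le hv hj.1 hj.2 x)

theorem integral_sum_hatBasis_sq (hv : ∀ k ≤ M, v k < v (k + 1)) (hM : 2 ≤ M) (c : ℕ → ℝ)
    {a b : ℝ} (ha : v 1 ≤ a) (hb : b ≤ v M) :
    ∫ x in Set.Icc a b, (∑ j ∈ Finset.Icc 1 M, c j * hatBasis v j x) ^ 2 =
      ∑ j ∈ Finset.Icc 1 M,
        ∑ j' ∈ (Finset.Icc 1 M).filter (fun j' => j' ≤ j + 1 ∧ j ≤ j' + 1),
          c j * c j' * ∫ x in Set.Icc a b, hatBasis v j x * hatBasis v j' x := by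
  have hint : ∀ j ∈ Finset.Icc 1 M, ∀ j' ∈ Finset.Icc 1 M,
      Integrable (fun x => c j * c j' * (hatBasis v j x * hatBasis v j' x))
        (volume.restrict (Set.Icc a b)) := fun j hj j' hj' =>
    ((memLp_hatBasis hv hj 2 _).integrable_mul (memLp_hatBasis hv hj' 2 _)).const_mul _
  calc _ = ∫ x in Set.Icc a b, ∑ j ∈ Finset.Icc 1 M, ∑ j' ∈ Finset.Icc 1 M,
        c j * c j' * (hatBasis v j x * hatBasis v j' x) := by
        congr with x
        rw [sq, Finset.sum_mul_sum]
        exact Finset.sum_congr rfl fun j _ => Finset.sum_congr rfl fun j' _ => by ring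
    _ = ∑ j ∈ Finset.Icc 1 M, ∑ j' ∈ Finset.Icc 1 M,
        c j * c j' * ∫ x in Set.Icc a b, hatBasis v j x * hatBasis v j' x := by
        rw [integral_finsetSum _ fun j hj => integrable_finsetSum _ (hint j hj)]
        refine Finset.sum_congr rfl fun j hj => ?_
        rw [integral_finsetSum _ (hint j hj)]
        exact Finset.sum_congr rfl fun j' _ => integral_const_mul _ _
    _ = _ := by
        refine Finset.sum_congr rfl fun j hj => ?_
        rw [Finset.sum_filter]
        refine Finset.sum_congr rfl fun j' hj' => ?_
        split_ifs with h
        · rfl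
        · rw [setIntegral_eq_zero_of_forall_eq_zero, mul_zero]
          exact fun x hx => hatBasis_mul_eq_zero hv hM hj hj' h (ha.trans hx.1) (hx.2.trans hb)

theorem sum_hatBasis_insert_knot (hv : ∀ k ≤ M, v k < v (k + 1)) (hM : 2 ≤ M)
    {w : ℕ → ℝ} (hw : ∀ k ≤ M + 1, w k < w (k + 1)) {t : ℝ} {ν : ℕ} (hν : 1 ≤ ν) (hνM : ν < M)
    (htl : v ν < t) (htr : t < v (ν + 1))
    (hwv : ∀ j, w j = if j ≤ ν then v j else if j = ν + 1 then t else v (j - 1))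
    {c d : ℕ → ℝ}
    (hd : ∀ j, d j = if j ≤ ν then c j else if j = ν + 1 then
        c ν * ((v (ν + 1) - t) / (v (ν + 1) - v ν)) +
          c (ν + 1) * ((t - v ν) / (v (ν + 1) - v ν)) else c (j - 1))
    {x : ℝ} (h1 : v 1 ≤ x) (h2 : x ≤ v M) :
    ∑ j ∈ Finset.Icc 1 M, c j * hatBasis v j x =
      ∑ j ∈ Finset.Icc 1 (M + 1), d j * hatBasis w j x := by
  have low : ∀ j ≤ ν, w j = v j ∧ d j = c j := fun j hj => by simp [hwv, hd, hj]
  have high : ∀ j, ν + 1 ≤ j → w (j + 1) = v j ∧ d (j + 1) = c j := fun j hj => by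
    rw [hwv, hd, if_neg (by omega), if_neg (by omega), if_neg (by omega), if_neg (by omega)]
    simp
  have mid : w (ν + 1) = t := by simp [hwv]
  have mid' : d (ν + 1) = c ν * ((v (ν + 1) - t) / (v (ν + 1) - v ν)) +
      c (ν + 1) * ((t - v ν) / (v (ν + 1) - v ν)) := by simp [hd]
  obtain ⟨k, hk, hkM, hk1, hk2⟩ := exists_cell hM h1 h2
  rw [sum_hatBasis hv c hk hkM hk1 hk2]
  rcases lt_trichotomy k ν with h | rfl | h
  · obtain ⟨e1, e2⟩ := low k h.le
    obtain ⟨e3, e4⟩ := low (k + 1) h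
    rw [sum_hatBasis hw d hk (by omega) (e1.trans_le hk1) (hk2.trans_eq e3.symm), e1, e2, e3, e4]
  · obtain ⟨e1, e2⟩ := low k le_rfl
    obtain ⟨e3, e4⟩ := high (k + 1) le_rfl
    have n1 : v (k + 1) - v k ≠ 0 := by linarith
    have n2 : v (k + 1) - t ≠ 0 := by linarith
    have n3 : t - v k ≠ 0 := by linarith
    rcases le_total x t with hx | hx
    · rw [sum_hatBasis hw d hk (by omega) (e1.trans_le hk1) (hx.trans_eq mid.symm),
        e1, e2, mid, mid']
      field_simp
      ring
    · rw [sum_hatBasis hw d (by omega : 1 ≤ k + 1) (by omega) (mid.trans_le hx)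
        (hk2.trans_eq e3.symm), e3, e4, mid, mid']
      field_simp
      ring
  · obtain ⟨e1, e2⟩ := high k h
    obtain ⟨e3, e4⟩ := high (k + 1) (by omega)
    rw [sum_hatBasis hw d (by omega : 1 ≤ k + 1) (by omega) (e1.trans_le hk1)
      (hk2.trans_eq e3.symm), e1, e2, e3, e4]

end Hat

/-- Second moment of a sum of functions of independent coordinates. -/
theorem integral_sum_eval_sq {ι : Type*} [Fintype ι] {Ω : ι → Type*} [∀ i, MeasurableSpace (Ω i)]
    (μ : ∀ i, Measure (Ω i)) [∀ i, IsProbabilityMeasure (μ i)] {g : ∀ i, Ω i → ℝ}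
    (hg : ∀ i, MemLp (g i) 2 (μ i)) :
    ∫ x, (∑ i, g i (x i)) ^ 2 ∂Measure.pi μ =
      (∑ i, ∫ s, g i s ^ 2 ∂μ i) - ∑ i, (∫ s, g i s ∂μ i) ^ 2 + (∑ i, ∫ s, g i s ∂μ i) ^ 2 := by
  have hmem : ∀ i, MemLp (fun x : ∀ i, Ω i => g i (x i)) 2 (Measure.pi μ) := fun i =>
    (hg i).comp_measurePreserving (measurePreserving_eval μ i)
  have hvar := ProbabilityTheory.variance_sum_pi hg
  rw [ProbabilityTheory.variance_eq_sub (memLp_finsetSum' _ fun i _ => hmem i)] at hvar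
  simp only [fun i => ProbabilityTheory.variance_eq_sub (hg i), Finset.sum_sub_distrib,
    Pi.pow_apply, Finset.sum_apply] at hvar
  rw [integral_finsetSum _ fun i _ => (hmem i).integrable one_le_two] at hvar
  simp only [fun i => integral_comp_eval (i := i) (hg i).aestronglyMeasurable] at hvar
  linarith

/-- Proposition 2: analytic expression of the squared-norm criterion when inserting
a knot `t` into the subdivision of the active variable `istar`. The set of active
variables `J` is the whole (finite) index type `ι`. -/
theorem stmt11 (ι : Type) [Fintype ι] [DecidableEq ι] (istar : ι)
    (m : ι → ℕ) (u : ι → ℕ → ℝ)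
    (hm : ∀ i, 2 ≤ m i)
    (hu0 : ∀ i, u i 0 = -1) (hu1 : ∀ i, u i 1 = 0)
    (hum : ∀ i, u i (m i) = 1) (hum1 : ∀ i, u i (m i + 1) = 2)
    (humono : ∀ i, ∀ j, 1 ≤ j → j < m i → u i j < u i (j + 1))
    (t : ℝ) (ν : ℕ) (hν1 : 1 ≤ ν) (hν2 : ν ≤ m istar - 1)
    (ht : u istar ν < t ∧ t < u istar (ν + 1))
    (mt : ι → ℕ) (hmt : ∀ i, mt i = if i = istar then m i + 1 else m i)
    (ut : ι → ℕ → ℝ)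
    (hut : ∀ i j, ut i j = if i = istar then
        (if j ≤ ν then u i j else if j = ν + 1 then t else u i (j - 1))
      else u i j)
    (ξh : ι → ℕ → ℝ) (ξt : ι → ℕ → ℝ)
    (ξb : ι → ℕ → ℝ)
    (hξb : ∀ i j, ξb i j = if i = istar then
        (if j ≤ ν then ξh i j
         else if j = ν + 1 then
           ξh i ν * ((u istar (ν + 1) - t) / (u istar (ν + 1) - u istar ν)) +
             ξh i (ν + 1) * ((t - u istar ν) / (u istar (ν + 1) - u istar ν))
         else ξh i (j - 1))
      else ξh i j)
    (ηb : ι → ℕ → ℝ) (hηb : ∀ i j, ηb i j = ξb i j - ξt i j)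
    (E : ι → ℕ → ℝ) (E2 : ι → ℕ → ℕ → ℝ)
    (hE : ∀ i j, E i j = ∫ s in (0:ℝ)..1, hatBasis (ut i) j s)
    (hE2 : ∀ i j j', E2 i j j' =
      ∫ s in (0:ℝ)..1, hatBasis (ut i) j s * hatBasis (ut i) j' s) :
    ∫ x in Set.Icc (0 : ι → ℝ) 1,
        ((∑ i, ∑ j ∈ Finset.Icc 1 (m i), ξh i j * hatBasis (u i) j (x i))
          - ∑ i, ∑ j ∈ Finset.Icc 1 (mt i), ξt i j * hatBasis (ut i) j (x i)) ^ 2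
      = (∑ i, ∑ j ∈ Finset.Icc 1 (mt i),
            ∑ j' ∈ (Finset.Icc 1 (mt i)).filter (fun j' => j' ≤ j + 1 ∧ j ≤ j' + 1),
              ηb i j * ηb i j' * E2 i j j')
        - (∑ i, (∑ j ∈ Finset.Icc 1 (mt i), ηb i j * E i j) ^ 2)
        + (∑ i, ∑ j ∈ Finset.Icc 1 (mt i), ηb i j * E i j) ^ 2 := by
  have hv : ∀ i, ∀ k ≤ m i, u i k < u i (k + 1) := by
    intro i k hk
    rcases Nat.eq_zero_or_pos k with rfl | h0
    · rw [hu0, zero_add, hu1]; norm_num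
    rcases hk.eq_or_lt with rfl | h
    · rw [hum, hum1]; norm_num
    · exact humono i k h0 h
  have hmi := hm istar
  have hw : ∀ i, ∀ k ≤ mt i, ut i k < ut i (k + 1) := by
    intro i k hk
    rw [hmt] at hk
    rw [hut, hut]
    by_cases hi : i = istar
    · subst hi
      simp only [if_true] at hk ⊢
      rcases lt_trichotomy k ν with h | rfl | h
      · rw [if_pos h.le, if_pos (by omega)]
        exact hv i k (by omega)
      · rw [if_pos le_rfl, if_neg (by omega), if_pos rfl]
        exact ht.1
      · rw [if_neg (by omega), if_neg (by omega : ¬ k + 1 ≤ ν), if_neg (by omega : k + 1 ≠ ν + 1),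
          Nat.add_sub_cancel]
        split_ifs with h5
        · rw [h5]; exact ht.2
        · exact knots_lt (hv i) (by omega) (by omega)
    · simp only [if_neg hi] at hk ⊢
      exact hv i k hk
  have hmt2 : ∀ i, 2 ≤ mt i := fun i => by
    have := hm i
    rw [hmt]; split_ifs <;> omega
  have hut1 : ∀ i, ut i 1 = 0 := fun i => by
    rw [hut, if_pos hν1, ite_self, hu1]
  have hutm : ∀ i, ut i (mt i) = 1 := fun i => by
    rw [hut, hmt]
    split_ifs with h1 h2 h3
    · subst h1; omega
    · subst h1; omega
    · rw [Nat.add_sub_cancel, hum]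
    · exact hum i
  have hpt : ∀ i, ∀ s ∈ Set.Icc (0 : ℝ) 1,
      ∑ j ∈ Finset.Icc 1 (m i), ξh i j * hatBasis (u i) j s =
        ∑ j ∈ Finset.Icc 1 (mt i), ξb i j * hatBasis (ut i) j s := by
    intro i s hs
    by_cases hi : i = istar
    · subst hi
      have hmti : mt i = m i + 1 := by rw [hmt, if_pos rfl]
      rw [hmti]
      exact sum_hatBasis_insert_knot (hv i) (hm i) (hmti ▸ hw i) hν1 (by omega) ht.1 ht.2
        (fun j => by rw [hut, if_pos rfl]) (fun j => by rw [hξb, if_pos rfl])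
        ((hu1 i).trans_le hs.1) (hs.2.trans_eq (hum i).symm)
    · have e1 : ut i = u i := funext fun j => by rw [hut, if_neg hi]
      have e2 : ξb i = ξh i := funext fun j => by rw [hξb, if_neg hi]
      rw [e1, e2, hmt, if_neg hi]
  have hIE : ∀ f : ℝ → ℝ, ∫ s in (0:ℝ)..1, f s = ∫ s in Set.Icc (0:ℝ) 1, f s := fun f => by
    rw [intervalIntegral.integral_of_le zero_le_one, integral_Icc_eq_integral_Ioc]
  let g : ι → ℝ → ℝ := fun i s => ∑ j ∈ Finset.Icc 1 (mt i), ηb i j * hatBasis (ut i) j s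
  have hmean : ∀ i, ∫ s in Set.Icc (0:ℝ) 1, g i s =
      ∑ j ∈ Finset.Icc 1 (mt i), ηb i j * E i j := fun i => by
    rw [integral_finsetSum _ fun j hj =>
      ((memLp_hatBasis (hw i) hj 1 _).integrable le_rfl).const_mul _]
    exact Finset.sum_congr rfl fun j _ => by rw [integral_const_mul, hE, hIE]
  have hsq : ∀ i, ∫ s in Set.Icc (0:ℝ) 1, g i s ^ 2 =
      ∑ j ∈ Finset.Icc 1 (mt i),
        ∑ j' ∈ (Finset.Icc 1 (mt i)).filter (fun j' => j' ≤ j + 1 ∧ j ≤ j' + 1),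
          ηb i j * ηb i j' * E2 i j j' := fun i => by
    simp only [hE2, hIE]
    exact integral_sum_hatBasis_sq (hw i) (hmt2 i) (ηb i) (hut1 i).le (hutm i).ge
  have hprob : IsProbabilityMeasure (volume.restrict (Set.Icc (0:ℝ) 1)) := ⟨by simp⟩
  have hg : ∀ i, MemLp (g i) 2 (volume.restrict (Set.Icc (0:ℝ) 1)) := fun i =>
    memLp_finsetSum _ fun j hj => (memLp_hatBasis (hw i) hj 2 _).const_mul _
  have hvol : (volume : Measure (ι → ℝ)).restrict (Set.Icc 0 1) =
      Measure.pi fun _ => volume.restrict (Set.Icc (0:ℝ) 1) := by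
    rw [← Set.pi_univ_Icc, volume_pi, Measure.restrict_pi_pi]
    rfl
  simp only [← hmean, ← hsq]
  rw [← integral_sum_eval_sq _ hg, ← hvol]
  refine setIntegral_congr_fun measurableSet_Icc fun x hx => ?_
  simp only [g, hηb, sub_mul, Finset.sum_sub_distrib]
  rw [Finset.sum_congr rfl fun i _ => hpt i (x i) ⟨hx.1 i, hx.2 i⟩]
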